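/- Let p be a prime, τ ∈ K \ {0} (K a number field with place v above p), d ≥ 1, and Λ_1,…,Λ_d ∈ GL_ν(ℚ) pairwise commuting matrices all of whose eigenvalues lie in ℚ ∩ ℤ_p \ ℤ. Given a family (Y_α)_{α ∈ ℕ^d} of μ×ν matrices over K, define Z_α = Y_α · ∏_{i=1}^d C_{Λ_i,τ}(α_i) where C_{Λ,τ}(n) = τ^{-n}(Λ+nI)⋯(Λ+I) for n ≥ 1 and C_{Λ,τ}(0) = I. Then limsup_{|α|→∞} ‖Z_α‖_v^{1/|α|} ≤ p^{-1/(p-1)} |τ|_v^{-1} · limsup_{|α|→∞} ‖Y_α‖_v^{1/|α|}. -/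

import Mathlib

open Filter

section

variable {K : Type*} [Field K] {ι : Type*} [Fintype ι] [DecidableEq ι]

/-- `upProd Λ n = (Λ + nI)(Λ + (n-1)I)⋯(Λ + I)`. -/
def upProd (Λ : Matrix ι ι K) : ℕ → Matrix ι ι K
  | 0 => 1
  | m + 1 => (Λ + ((m : K) + 1) • (1 : Matrix ι ι K)) * upProd Λ m

end

/-- Entrywise max norm of a matrix over a normed field. -/
noncomputable def matMaxNorm {L : Type*} [NormedField L] {m n : Type*} [Fintype m] [Fintype n]
    [Nonempty m] [Nonempty n] (Y : Matrix m n L) : ℝ :=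
  Finset.univ.sup' Finset.univ_nonempty
    (fun i : m => Finset.univ.sup' Finset.univ_nonempty (fun j : n => ‖Y i j‖))


section helpers
set_option linter.unusedSectionVars false
open Polynomial

variable {p : ℕ} [hpf : Fact p.Prime] {L : Type*} [NontriviallyNormedField L] [CharZero L]
  [hu : IsUltrametricDist L]

theorem aux_sub_le (x y : L) : ‖x - y‖ ≤ max ‖x‖ ‖y‖ := by
  have := IsUltrametricDist.norm_add_le_max x (-y)
  rwa [norm_neg, ← sub_eq_add_neg] at this

theorem aux_norm_coprime (hp : ‖(p : L)‖ = (p : ℝ)⁻¹) (m : ℕ) (hm : ¬ p ∣ m) :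
    ‖(m : L)‖ = 1 := by
  have h1 : ‖(m : L)‖ ≤ 1 := IsUltrametricDist.norm_natCast_le_one L m
  refine le_antisymm h1 ?_
  by_contra hlt
  push Not at hlt
  have hc : IsCoprime (p : ℤ) (m : ℤ) :=
    Nat.isCoprime_iff_coprime.mpr ((Nat.Prime.coprime_iff_not_dvd hpf.out).2 hm)
  obtain ⟨a, b, hab⟩ := hc
  have h2 : (a : L) * p + b * m = 1 := by exact_mod_cast congrArg (Int.cast : ℤ → L) hab
  have ha : ‖(a : L)‖ ≤ 1 := IsUltrametricDist.norm_intCast_le_one L a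
  have hb : ‖(b : L)‖ ≤ 1 := IsUltrametricDist.norm_intCast_le_one L b
  have hpp : ‖(p : L)‖ < 1 := by
    rw [hp]
    exact inv_lt_one_of_one_lt₀ (by exact_mod_cast hpf.out.one_lt)
  have h3 := IsUltrametricDist.norm_add_le_max ((a : L) * p) (b * m)
  rw [h2, norm_one, norm_mul, norm_mul] at h3
  have h4 : ‖(a : L)‖ * ‖(p : L)‖ < 1 :=
    lt_of_le_of_lt (mul_le_of_le_one_left (norm_nonneg _) ha) hpp
  have h5 : ‖(b : L)‖ * ‖(m : L)‖ < 1 :=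
    lt_of_le_of_lt (mul_le_of_le_one_left (norm_nonneg _) hb) hlt
  exact absurd h3 (not_le.2 (max_lt h4 h5))

theorem aux_norm_nat (hp : ‖(p : L)‖ = (p : ℝ)⁻¹) (n : ℕ) :
    ‖(n : L)‖ = ‖(n : ℚ_[p])‖ := by
  rcases eq_or_ne n 0 with rfl | hn
  · simp
  obtain ⟨v, m, hm, rfl⟩ := Nat.exists_eq_pow_mul_and_not_dvd hn p hpf.out.ne_one
  push_cast
  rw [norm_mul, norm_mul, norm_pow, norm_pow, aux_norm_coprime hp m hm, hp,
    aux_norm_coprime (L := ℚ_[p]) Padic.norm_p m hm, Padic.norm_p]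

theorem aux_norm_rat (hp : ‖(p : L)‖ = (p : ℝ)⁻¹) (q : ℚ) :
    ‖(q : L)‖ = ‖(q : ℚ_[p])‖ := by
  have hint : ∀ z : ℤ, ‖(z : L)‖ = ‖(z : ℚ_[p])‖ := by
    intro z
    obtain ⟨m, rfl | rfl⟩ := Int.eq_nat_or_neg z
    · simpa using aux_norm_nat hp m
    · simpa using aux_norm_nat hp m
  rw [Rat.cast_def, Rat.cast_def, norm_div, norm_div, hint, aux_norm_nat hp]

theorem aux_norm_nat_val (hp : ‖(p : L)‖ = (p : ℝ)⁻¹) (n : ℕ) (hn : n ≠ 0) :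
    ‖(n : L)‖ = ((p : ℝ) ^ padicValNat p n)⁻¹ := by
  rw [aux_norm_nat hp, Padic.norm_eq_zpow_neg_valuation (by exact_mod_cast hn),
    Padic.valuation_natCast, zpow_neg, zpow_natCast]

theorem aux_norm_nat_ge (hp : ‖(p : L)‖ = (p : ℝ)⁻¹) (n : ℕ) (hn : n ≠ 0) :
    (n : ℝ)⁻¹ ≤ ‖(n : L)‖ := by
  rw [aux_norm_nat_val hp n hn]
  have : p ^ padicValNat p n ≤ n := Nat.le_of_dvd (Nat.pos_of_ne_zero hn) pow_padicValNat_dvd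
  have h0 : 0 < p ^ padicValNat p n := pow_pos hpf.out.pos _
  gcongr
  · exact_mod_cast h0
  · exact_mod_cast this

theorem aux_approx (hp : ‖(p : L)‖ = (p : ℝ)⁻¹) (x : ℚ) (hx : ‖(x : L)‖ ≤ 1) (M : ℕ) :
    ∃ g : ℕ, g < p ^ M ∧ ‖(x : L) - g‖ ≤ ((p : ℝ) ^ M)⁻¹ := by
  have hx' : ‖(x : ℚ_[p])‖ ≤ 1 := by rwa [← aux_norm_rat hp]
  let z : ℤ_[p] := ⟨x, hx'⟩
  refine ⟨z.appr M, z.appr_lt M, ?_⟩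
  have h1 := (PadicInt.norm_le_pow_iff_mem_span_pow _ M).2 (PadicInt.appr_spec M z)
  have h2 : (x : L) - (z.appr M : ℕ) = ((x - (z.appr M : ℕ) : ℚ) : L) := by push_cast; rfl
  rw [h2, aux_norm_rat hp]
  rw [PadicInt.norm_def] at h1
  push_cast at h1 ⊢
  simpa [z, zpow_neg] using h1

theorem aux_dense (hp : ‖(p : L)‖ = (p : ℝ)⁻¹) (f : L → L) (hf : Continuous f) (c : ℚ)
    (hc : ‖(c : L)‖ ≤ 1) (B : ℝ) (hB : ∀ m : ℕ, ‖f (c + m)‖ ≤ B) (x : ℚ) (hx : ‖(x : L)‖ ≤ 1) :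
    ‖f x‖ ≤ B := by
  have hxc : ‖((x - c : ℚ) : L)‖ ≤ 1 := by
    push_cast
    exact (aux_sub_le _ _).trans (max_le hx hc)
  choose g _ hg using aux_approx hp (x - c) hxc
  have hlim : Tendsto (fun M => (c : L) + g M) atTop (nhds (x : L)) := by
    rw [tendsto_iff_norm_sub_tendsto_zero]
    refine squeeze_zero (fun _ => norm_nonneg _) (g := fun M => ((p : ℝ) ^ M)⁻¹) ?_ ?_
    · intro M
      have := hg M
      push_cast at this
      rw [norm_sub_rev] at this
      have h2 : (c : L) + g M - x = g M - (x - c) := by ring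
      rwa [h2]
    · exact (tendsto_pow_atTop_atTop_of_one_lt
        (by exact_mod_cast hpf.out.one_lt)).inv_tendsto_atTop
  exact le_of_tendsto' ((hf.tendsto _).comp hlim).norm (fun M => hB (g M))

theorem aux_step (hp : ‖(p : L)‖ = (p : ℝ)⁻¹) (P : L[X]) (n : ℕ) (hP : P.natDegree ≤ n)
    (B : ℝ) (hB : ∀ m : ℕ, ‖P.eval (m : L)‖ ≤ B) (c : ℚ) (hc : ‖(c : L)‖ ≤ 1) :
    ‖P.eval (c : L)‖ ≤ B ∧ ∃ Q : L[X], Q.natDegree ≤ n ∧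
      (∀ m : ℕ, ‖Q.eval (m : L)‖ ≤ B * (n + 1)) ∧
      P = (X - C (c : L)) * Q + C (P.eval (c : L)) := by
  have hB0 : 0 ≤ B := (norm_nonneg _).trans (hB 0)
  have hall : ∀ x : ℚ, ‖(x : L)‖ ≤ 1 → ‖P.eval (x : L)‖ ≤ B := fun x hx =>
    aux_dense hp (fun y => P.eval y) P.continuous 0 (by simp) B (by simpa using hB) x hx
  refine ⟨hall c hc, P /ₘ (X - C (c : L)), ?_, ?_, ?_⟩
  · rw [natDegree_divByMonic _ (monic_X_sub_C _)]
    omega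
  · set Q := P /ₘ (X - C (c : L)) with hQ
    have hPQ : P = (X - C (c : L)) * Q + C (P.eval (c : L)) := by
      have := modByMonic_add_div P (X - C (c : L))
      rw [modByMonic_X_sub_C_eq_C_eval] at this
      rw [add_comm]; exact this.symm
    have hQd : Q.natDegree ≤ n := by
      rw [hQ, natDegree_divByMonic _ (monic_X_sub_C _)]
      omega
    have hc1 : ‖((c + 1 : ℚ) : L)‖ ≤ 1 := by
      push_cast
      exact (IsUltrametricDist.norm_add_le_max _ _).trans (max_le hc (by simp))
    have hBn : 0 ≤ B * (n + 1) := by positivity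
    have hval : ∀ k : ℕ, k ≤ n → ‖Q.eval ((c : L) + 1 + k)‖ ≤ B * (n + 1) := by
      intro k hk
      have h1 : P.eval ((c : L) + 1 + k) - P.eval (c : L) = ((k + 1 : ℕ) : L) *
          Q.eval ((c : L) + 1 + k) := by
        conv_lhs => rw [hPQ]
        simp only [eval_add, eval_mul, eval_sub, eval_X, eval_C]
        push_cast
        ring
      have h2 : ‖P.eval ((c : L) + 1 + k) - P.eval (c : L)‖ ≤ B := by
        refine (aux_sub_le _ _).trans (max_le ?_ (hall c hc))
        have := hall (c + 1 + k) (by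
          push_cast
          refine (IsUltrametricDist.norm_add_le_max _ _).trans (max_le (by simpa using hc1) ?_)
          exact IsUltrametricDist.norm_natCast_le_one L k)
        simpa using this
      rw [h1, norm_mul] at h2
      have h3 := aux_norm_nat_ge hp (k + 1) (Nat.succ_ne_zero k)
      have h4 : ((k + 1 : ℕ) : ℝ)⁻¹ * ‖Q.eval ((c : L) + 1 + k)‖ ≤ B :=
        (mul_le_mul_of_nonneg_right h3 (norm_nonneg _)).trans h2
      rw [inv_mul_le_iff₀ (by positivity)] at h4
      refine h4.trans ?_
      rw [mul_comm]
      gcongr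
      push_cast
      gcongr
    have hdiff : ∀ k : ℕ, ‖(fwdDiff (1 : L))^[k] Q.eval ((c : L) + 1)‖ ≤ B * (n + 1) := by
      intro k
      rcases le_or_gt k n with hk | hk
      · rw [fwdDiff_iter_eq_sum_shift]
        refine IsUltrametricDist.norm_sum_le_of_forall_le_of_nonneg hBn ?_
        intro i hi
        rw [zsmul_eq_mul, norm_mul]
        have := hval i (by have := Finset.mem_range.1 hi; omega)
        rw [nsmul_one]
        exact (mul_le_of_le_one_left (norm_nonneg _)
          (IsUltrametricDist.norm_intCast_le_one L _)).trans this
      · rw [Polynomial.fwdDiff_iter_eq_zero_of_degree_lt (lt_of_le_of_lt hQd hk)]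
        simpa using hBn
    have hval2 : ∀ m : ℕ, ‖Q.eval (((c + 1 : ℚ) : L) + m)‖ ≤ B * (n + 1) := by
      intro m
      have := shift_eq_sum_fwdDiff_iter (1 : L) Q.eval m ((c : L) + 1)
      rw [nsmul_one] at this
      push_cast
      rw [this]
      refine IsUltrametricDist.norm_sum_le_of_forall_le_of_nonneg hBn ?_
      intro i _
      rw [nsmul_eq_mul, norm_mul]
      exact (mul_le_of_le_one_left (norm_nonneg _)
        (IsUltrametricDist.norm_natCast_le_one L _)).trans (hdiff i)
    intro m
    have := aux_dense hp (fun y => Q.eval y) Q.continuous (c + 1) hc1 _ hval2 m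
      (by simpa using IsUltrametricDist.norm_natCast_le_one L m)
    simpa using this
  · have := modByMonic_add_div P (X - C (c : L))
    rw [modByMonic_X_sub_C_eq_C_eval] at this
    rw [add_comm]; exact this.symm


theorem aux_mat_le {m n : Type*} [Fintype m] [Fintype n] [Nonempty m] [Nonempty n]
    (A : Matrix m n L) (r : ℝ) : matMaxNorm A ≤ r ↔ ∀ i j, ‖A i j‖ ≤ r := by
  simp [matMaxNorm, Finset.sup'_le_iff]

theorem aux_entry_le {m n : Type*} [Fintype m] [Fintype n] [Nonempty m] [Nonempty n]
    (A : Matrix m n L) (i : m) (j : n) : ‖A i j‖ ≤ matMaxNorm A :=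
  (aux_mat_le A _).1 le_rfl i j

theorem aux_mat_nonneg {m n : Type*} [Fintype m] [Fintype n] [Nonempty m] [Nonempty n]
    (A : Matrix m n L) : 0 ≤ matMaxNorm A :=
  (norm_nonneg _).trans (aux_entry_le A (Classical.arbitrary m) (Classical.arbitrary n))

theorem aux_mat_mul {m n k : Type*} [Fintype m] [Fintype n] [Fintype k] [Nonempty m] [Nonempty n]
    [Nonempty k] (A : Matrix m n L) (B : Matrix n k L) :
    matMaxNorm (A * B) ≤ matMaxNorm A * matMaxNorm B := by
  rw [aux_mat_le]
  intro i j
  rw [Matrix.mul_apply]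
  refine IsUltrametricDist.norm_sum_le_of_forall_le_of_nonneg
    (mul_nonneg (aux_mat_nonneg A) (aux_mat_nonneg B)) ?_
  intro x _
  rw [norm_mul]
  exact mul_le_mul (aux_entry_le A _ _) (aux_entry_le B _ _) (norm_nonneg _) (aux_mat_nonneg A)

theorem aux_mat_smul {m n : Type*} [Fintype m] [Fintype n] [Nonempty m] [Nonempty n]
    (c : L) (A : Matrix m n L) : matMaxNorm (c • A) ≤ ‖c‖ * matMaxNorm A := by
  rw [aux_mat_le]
  intro i j
  rw [Matrix.smul_apply, smul_eq_mul, norm_mul]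
  exact mul_le_mul_of_nonneg_left (aux_entry_le A _ _) (norm_nonneg _)

theorem aux_mat_one {n : Type*} [Fintype n] [Nonempty n] [DecidableEq n] :
    matMaxNorm (1 : Matrix n n L) ≤ 1 := by
  rw [aux_mat_le]
  intro i j
  rw [Matrix.one_apply]
  split_ifs <;> simp

theorem aux_mat_list {n : Type*} [Fintype n] [Nonempty n] [DecidableEq n]
    (l : List (Matrix n n L)) : matMaxNorm l.prod ≤ (l.map matMaxNorm).prod := by
  induction l with
  | nil => simpa using aux_mat_one
  | cons a l ih =>
    rw [List.prod_cons, List.map_cons, List.prod_cons]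
    exact (aux_mat_mul _ _).trans (mul_le_mul_of_nonneg_left ih (aux_mat_nonneg _))

theorem aux_det_le {n : Type*} [Fintype n] [DecidableEq n] (A : Matrix n n L) (R : ℝ) (hR : 0 ≤ R)
    (h : ∀ i j, ‖A i j‖ ≤ R) : ‖A.det‖ ≤ R ^ Fintype.card n := by
  rw [Matrix.det_apply]
  refine IsUltrametricDist.norm_sum_le_of_forall_le_of_nonneg (by positivity) ?_
  intro σ _
  have : ‖Equiv.Perm.sign σ • ∏ i, A (σ i) i‖ = ‖∏ i, A (σ i) i‖ := by
    rcases Int.units_eq_one_or (Equiv.Perm.sign σ) with h | h <;> simp [h]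
  rw [this, norm_prod]
  refine (Finset.prod_le_prod (fun _ _ => norm_nonneg _) (fun i _ => h (σ i) i)).trans ?_
  simp

theorem aux_adj_le {n : Type*} [Fintype n] [DecidableEq n] [Nonempty n] (A : Matrix n n L) (R : ℝ)
    (hR : 1 ≤ R) (h : matMaxNorm A ≤ R) : matMaxNorm A.adjugate ≤ R ^ Fintype.card n := by
  rw [aux_mat_le] at h ⊢
  intro i j
  rw [Matrix.adjugate_apply]
  refine aux_det_le _ R (by linarith) ?_
  intro a b
  rw [Matrix.updateRow_apply]
  split_ifs
  · rw [Pi.single_apply]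
    split_ifs
    · simpa using hR
    · simp; linarith
  · exact h a b

theorem aux_inv {m n : Type*} [Fintype m] [Fintype n] [Nonempty m] [Nonempty n] [DecidableEq n]
    (Y : Matrix m n L) (A : Matrix n n L) (R T : ℝ) (hR : 1 ≤ R) (h : matMaxNorm A ≤ R)
    (hT : 1 ≤ ‖A.det‖ * T) :
    matMaxNorm Y ≤ matMaxNorm (Y * A) * (T * R ^ Fintype.card n) := by
  have hd : 0 < ‖A.det‖ := by
    rcases (norm_nonneg A.det).eq_or_lt with h0 | h0
    · rw [← h0] at hT; norm_num at hT
    · exact h0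
  have h1 : Y = (A.det)⁻¹ • ((Y * A) * A.adjugate) := by
    rw [Matrix.mul_assoc, Matrix.mul_adjugate, Matrix.mul_smul, Matrix.mul_one, smul_smul,
      inv_mul_cancel₀ (norm_pos_iff.1 hd), one_smul]
  have h2 : matMaxNorm Y ≤ ‖(A.det)⁻¹‖ * (matMaxNorm (Y * A) * R ^ Fintype.card n) := by
    conv_lhs => rw [h1]
    refine (aux_mat_smul _ _).trans (mul_le_mul_of_nonneg_left ?_ (norm_nonneg _))
    exact (aux_mat_mul _ _).trans
      (mul_le_mul_of_nonneg_left (aux_adj_le A R hR h) (aux_mat_nonneg _))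
  refine h2.trans ?_
  have h3 : ‖(A.det)⁻¹‖ ≤ T := by
    rw [norm_inv, inv_le_iff_one_le_mul₀' hd]
    exact hT
  have h4 : 0 ≤ matMaxNorm (Y * A) * R ^ Fintype.card n :=
    mul_nonneg (aux_mat_nonneg _) (by positivity)
  calc _ ≤ T * (matMaxNorm (Y * A) * R ^ Fintype.card n) := mul_le_mul_of_nonneg_right h3 h4
    _ = _ := by ring

theorem aux_interp (hp : ‖(p : L)‖ = (p : ℝ)⁻¹) {n : Type*} [Fintype n] [DecidableEq n] [Nonempty n]
    (A : Matrix n n L) (l : List ℚ) (hl : ∀ c ∈ l, ‖(c : L)‖ ≤ 1) :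
    ∀ R : Matrix n n L, aeval A (l.map (fun c : ℚ => X - C (c : L))).prod * R = 0 →
    ∃ K : ℝ, 0 ≤ K ∧ ∀ (N : ℕ) (B : ℝ) (P : L[X]), P.natDegree ≤ N →
      (∀ m : ℕ, ‖P.eval (m : L)‖ ≤ B) →
      matMaxNorm (aeval A P * R) ≤ K * B * (N + 1) ^ l.length := by
  induction l with
  | nil =>
    intro R hR
    have hR0 : R = 0 := by simpa using hR
    refine ⟨0, le_rfl, fun N B P _ _ => ?_⟩
    rw [hR0, aux_mat_le]
    simp
  | cons c l ih =>
    intro R hR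
    have hR' : aeval A (l.map (fun c : ℚ => X - C (c : L))).prod *
        (aeval A (X - C (c : L)) * R) = 0 := by
      rw [← Matrix.mul_assoc, ← map_mul, mul_comm]
      simpa using hR
    obtain ⟨K, hK, h⟩ := ih (fun c' hc' => hl c' (List.mem_cons_of_mem _ hc')) _ hR'
    refine ⟨max K (matMaxNorm R), hK.trans (le_max_left _ _), fun N B P hP hB => ?_⟩
    have hB0 : 0 ≤ B := (norm_nonneg _).trans (hB 0)
    obtain ⟨h1, Q, hQd, hQB, hPQ⟩ := aux_step hp P N hP B hB c (hl c List.mem_cons_self)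
    have h2 := h N _ Q hQd hQB
    have h3 : aeval A P * R = aeval A Q * (aeval A (X - C (c : L)) * R) + P.eval (c : L) • R := by
      conv_lhs => rw [hPQ]
      rw [map_add, map_mul, aeval_C, Matrix.add_mul, Algebra.algebraMap_eq_smul_one, Matrix.smul_mul,
        Matrix.one_mul, ← map_mul, mul_comm (X - C (c : L)) Q, map_mul, Matrix.mul_assoc]
    rw [h3, aux_mat_le]
    intro i j
    rw [Matrix.add_apply]
    refine (IsUltrametricDist.norm_add_le_max _ _).trans (max_le ?_ ?_)
    · refine (aux_entry_le _ i j).trans (h2.trans ?_)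
      calc K * (B * (N + 1)) * (N + 1) ^ l.length = K * B * (N + 1) ^ (l.length + 1) := by ring
        _ ≤ _ := by
          rw [List.length_cons]
          gcongr
          exact le_max_left _ _
    · rw [Matrix.smul_apply, smul_eq_mul, norm_mul]
      have h4 : ‖R i j‖ ≤ max K (matMaxNorm R) := (aux_entry_le R i j).trans (le_max_right _ _)
      have h5 : (1 : ℝ) ≤ (N + 1) ^ (c :: l).length := one_le_pow₀ (by simp)
      calc ‖P.eval (c : L)‖ * ‖R i j‖ ≤ B * max K (matMaxNorm R) := by gcongr
        _ = max K (matMaxNorm R) * B := mul_comm _ _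
        _ ≤ _ := le_mul_of_one_le_right (mul_nonneg (hK.trans (le_max_left _ _)) hB0) h5

theorem aux_upProd_eq {n : Type*} [Fintype n] [DecidableEq n] (A : Matrix n n L) (N : ℕ) :
    upProd A N = aeval A (∏ k ∈ Finset.range N, (X + C ((k : L) + 1))) := by
  induction N with
  | zero => simp [upProd]
  | succ N ih =>
    rw [upProd, ih, Finset.prod_range_succ, mul_comm, map_mul, map_add, aeval_X, aeval_C,
      Algebra.algebraMap_eq_smul_one]

theorem aux_fact_upper (hp : ‖(p : L)‖ = (p : ℝ)⁻¹) (N : ℕ) :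
    ‖(N.factorial : L)‖ ≤ p * (N + 1) * ((p : ℝ) ^ (-(1 : ℝ) / ((p : ℝ) - 1))) ^ N := by
  have hp1 : (1 : ℝ) < p := by exact_mod_cast hpf.out.one_lt
  have hp0 : (0 : ℝ) < p := by linarith
  rw [aux_norm_nat_val hp _ N.factorial_ne_zero]
  set v := padicValNat p N.factorial with hv
  set len := (p.digits N).length with hlen
  have h1 : (p - 1) * v = N - (p.digits N).sum := sub_one_mul_padicValNat_factorial N
  have h2 : (p.digits N).sum ≤ len * (p - 1) := by
    have := List.sum_le_card_nsmul (p.digits N) (p - 1) (fun x hx => by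
      have := Nat.digits_lt_base hpf.out.one_lt hx
      omega)
    simpa using this
  have h3 : N ≤ (p - 1) * (v + len) := by
    have : (p - 1) * (v + len) = (p - 1) * v + len * (p - 1) := by ring
    omega
  have h4 : (p : ℝ) ^ len ≤ p * (N + 1) := by
    rcases Nat.eq_zero_or_pos N with h0 | h0
    · have : len = 0 := by rw [hlen, h0]; simp
      rw [this, h0]; simpa using hp1.le
    · have := Nat.base_pow_length_digits_le p N hpf.out.one_lt h0.ne'
      have h5 : (p : ℝ) ^ len ≤ p * N := by exact_mod_cast this
      nlinarith
  have h5 : (N : ℝ) ≤ (p - 1) * (v + len) := by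
    have : ((p - 1 : ℕ) : ℝ) = p - 1 := by
      rw [Nat.cast_sub hpf.out.one_lt.le]; simp
    rw [← this]
    exact_mod_cast h3
  have h6 : (N : ℝ) / (p - 1) ≤ ((v + len : ℕ) : ℝ) := by
    rw [div_le_iff₀ (by linarith)]
    push_cast
    linarith
  have h7 : (p : ℝ) ^ ((N : ℝ) / (p - 1)) ≤ p ^ v * p ^ len := by
    rw [← pow_add, ← Real.rpow_natCast]
    exact Real.rpow_le_rpow_of_exponent_le hp1.le h6
  have h8 : ((p : ℝ) ^ (-(1 : ℝ) / ((p : ℝ) - 1))) ^ N = ((p : ℝ) ^ ((N : ℝ) / (p - 1)))⁻¹ := by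
    rw [← Real.rpow_natCast, ← Real.rpow_mul hp0.le, ← Real.rpow_neg hp0.le]
    congr 1
    ring
  rw [h8, ← div_eq_mul_inv, le_div_iff₀ (by positivity), inv_mul_le_iff₀ (by positivity)]
  exact h7.trans (by gcongr)

theorem aux_up_upper (hp : ‖(p : L)‖ = (p : ℝ)⁻¹) {ν : ℕ} [NeZero ν]
    (A : Matrix (Fin ν) (Fin ν) ℚ) (γ : Fin ν → ℚ)
    (hcp : A.charpoly = ∏ j, (X - C (γ j))) (hint : ∀ j, ‖((γ j : ℚ) : L)‖ ≤ 1) :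
    ∃ K : ℝ, 1 ≤ K ∧ ∀ N : ℕ, matMaxNorm (upProd (A.map (fun q : ℚ => (q : L))) N) ≤
      K * (N + 1) ^ (ν + 1) * ((p : ℝ) ^ (-(1 : ℝ) / ((p : ℝ) - 1))) ^ N := by
  have hp1 : (1 : ℝ) < p := by exact_mod_cast hpf.out.one_lt
  set A' : Matrix (Fin ν) (Fin ν) L := A.map (fun q : ℚ => (q : L)) with hA'
  have hA'' : A' = A.map (Rat.castHom L) := rfl
  have hch : A'.charpoly = ((List.ofFn γ).map (fun c : ℚ => X - C (c : L))).prod := by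
    rw [hA'', Matrix.charpoly_map, hcp, Polynomial.map_prod, List.map_ofFn, List.prod_ofFn]
    simp
  obtain ⟨K, hK, h⟩ := aux_interp hp A' (List.ofFn γ) (by simpa [List.mem_ofFn] using hint) 1
    (by rw [← hch, Matrix.aeval_self_charpoly, zero_mul])
  refine ⟨max 1 (K * p), le_max_left _ _, fun N => ?_⟩
  have hd : (∏ k ∈ Finset.range N, (X + C ((k : L) + 1))).natDegree ≤ N := by
    refine (natDegree_prod_le _ _).trans ?_
    refine (Finset.sum_le_card_nsmul _ _ 1 (fun k _ => ?_)).trans (by simp)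
    exact (natDegree_X_add_C _).le
  have hb : ∀ m : ℕ, ‖(∏ k ∈ Finset.range N, (X + C ((k : L) + 1))).eval (m : L)‖ ≤
      ‖(N.factorial : L)‖ := by
    intro m
    have h1 : (∏ k ∈ Finset.range N, (X + C ((k : L) + 1))).eval (m : L) =
        (((m + 1).ascFactorial N : ℕ) : L) := by
      rw [eval_prod, Nat.ascFactorial_eq_prod_range]
      push_cast
      refine Finset.prod_congr rfl fun k _ => ?_
      simp
      ring
    obtain ⟨t, ht⟩ := Nat.factorial_dvd_ascFactorial (m + 1) N
    rw [h1, ht]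
    push_cast
    rw [norm_mul]
    exact mul_le_of_le_one_right (norm_nonneg _) (IsUltrametricDist.norm_natCast_le_one L t)
  have h1 := h N _ _ hd hb
  rw [mul_one, ← aux_upProd_eq, List.length_ofFn] at h1
  have h2 := aux_fact_upper hp N
  set π := ((p : ℝ) ^ (-(1 : ℝ) / ((p : ℝ) - 1)))
  have hπ : 0 ≤ π := by positivity
  calc _ ≤ _ := h1
    _ ≤ K * (p * (N + 1) * π ^ N) * (N + 1) ^ ν := by gcongr
    _ = (K * p) * (N + 1) ^ (ν + 1) * π ^ N := by ring
    _ ≤ _ := by gcongr; exact le_max_right _ _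


theorem aux_poch_lower (hp : ‖(p : L)‖ = (p : ℝ)⁻¹) (c : ℚ) (hc : ‖(c : L)‖ ≤ 1)
    (hz : ∀ z : ℤ, c ≠ (z : ℚ)) :
    ∃ D E : ℝ, 1 ≤ D ∧ 1 ≤ E ∧ ∀ N : ℕ,
      1 ≤ ‖∏ k ∈ Finset.range N, ((c : L) + ((k : L) + 1))‖ * (D * E ^ N) := by
  have hp1 : (1 : ℝ) < p := by exact_mod_cast hpf.out.one_lt
  have hp0 : (0 : ℝ) < p := by linarith
  refine ⟨(p : ℝ) ^ c.num.natAbs, (p : ℝ) ^ (2 + c.den), one_le_pow₀ hp1.le, one_le_pow₀ hp1.le, ?_⟩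
  intro N
  set H := c.num.natAbs + N * c.den with hH
  obtain ⟨g, hg, hg2⟩ := aux_approx hp c hc H
  have key : ∀ k ∈ Finset.range N, ‖(c : L) + ((k : L) + 1)‖ = ‖((g + 1 + k : ℕ) : L)‖ := by
    intro k hk
    have hkN := Finset.mem_range.1 hk
    set w : ℤ := c.num + (k + 1) * c.den with hw
    have hcd : c * c.den = c.num := Rat.mul_den_eq_num c
    have hw1 : ((c : L) + ((k : L) + 1)) * (c.den : L) = (w : L) := by
      have : (c + (k + 1)) * c.den = (w : ℚ) := by
        rw [hw]; push_cast; rw [add_mul, hcd]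
      exact_mod_cast congrArg (Rat.cast : ℚ → L) this
    have hw0 : w ≠ 0 := by
      intro h0
      have h1 : (c + (k + 1)) * c.den = (0 : ℚ) := by
        have : (c + (k + 1)) * c.den = (w : ℚ) := by
          rw [hw]; push_cast; rw [add_mul, hcd]
        rw [this, h0]; simp
      have h2 : c + (k + 1) = 0 := by
        rcases mul_eq_zero.1 h1 with h | h
        · exact h
        · exact absurd h (by exact_mod_cast c.den_nz)
      exact hz (-(k + 1)) (by push_cast; linarith)
    have hwle : w.natAbs ≤ H := by
      rw [hw, hH]
      refine (Int.natAbs_add_le _ _).trans ?_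
      rw [Int.natAbs_mul]
      have : ((k : ℤ) + 1).natAbs = k + 1 := by omega
      rw [this, Int.natAbs_natCast]
      gcongr
      omega
    have hwn : ‖(w : L)‖ = ‖(w.natAbs : L)‖ := by
      obtain ⟨m, h | h⟩ := Int.eq_nat_or_neg w <;> rw [h] <;> simp
    have hwpos : 0 < w.natAbs := Int.natAbs_pos.2 hw0
    have h3 : ((p : ℝ) ^ H)⁻¹ < ‖(w : L)‖ := by
      rw [hwn]
      refine lt_of_lt_of_le ?_ (aux_norm_nat_ge hp _ hwpos.ne')
      have h4 : w.natAbs < p ^ H := lt_of_le_of_lt hwle (Nat.lt_pow_self hpf.out.one_lt)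
      have h5 : (w.natAbs : ℝ) < (p : ℝ) ^ H := by exact_mod_cast h4
      exact inv_strictAnti₀ (by exact_mod_cast hwpos) h5
    have h6 : ‖(w : L)‖ ≤ ‖(c : L) + ((k : L) + 1)‖ := by
      rw [← hw1, norm_mul]
      exact mul_le_of_le_one_right (norm_nonneg _) (IsUltrametricDist.norm_natCast_le_one L _)
    have h7 : ‖(c : L) - g‖ < ‖(c : L) + ((k : L) + 1)‖ := lt_of_le_of_lt hg2 (h3.trans_le h6)
    have h8 : ((g + 1 + k : ℕ) : L) = ((c : L) + ((k : L) + 1)) - (c - g) := by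
      push_cast; ring
    rw [h8]
    refine le_antisymm ?_ ?_
    · by_contra hlt
      push Not at hlt
      have h9 := IsUltrametricDist.norm_add_le_max (((c : L) + ((k : L) + 1)) - (c - g)) (c - g)
      rw [sub_add_cancel] at h9
      exact absurd h9 (not_le.2 (max_lt hlt h7))
    · exact (aux_sub_le _ _).trans (max_le le_rfl h7.le)
  have hprod : ‖∏ k ∈ Finset.range N, ((c : L) + ((k : L) + 1))‖ =
      ‖(N.factorial : L)‖ * ‖(((g + N).choose N : ℕ) : L)‖ := by
    rw [norm_prod, Finset.prod_congr rfl key, ← norm_prod, ← norm_mul]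
    have := Nat.ascFactorial_eq_factorial_mul_choose g N
    rw [Nat.ascFactorial_eq_prod_range] at this
    congr 1
    exact_mod_cast this
  rw [hprod]
  have hf : 1 ≤ ‖(N.factorial : L)‖ * (p : ℝ) ^ N := by
    rw [aux_norm_nat_val hp _ N.factorial_ne_zero]
    rw [one_le_inv_mul₀ (by positivity)]
    refine pow_le_pow_right₀ hp1.le ?_
    have h1 := sub_one_mul_padicValNat_factorial (p := p) N
    have h2 : 1 ≤ p - 1 := by have := hpf.out.two_le; omega
    calc padicValNat p N.factorial ≤ (p - 1) * padicValNat p N.factorial :=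
          Nat.le_mul_of_pos_left _ h2
      _ ≤ N := by omega
  have hch : 1 ≤ ‖(((g + N).choose N : ℕ) : L)‖ * ((p : ℝ) ^ H * (p : ℝ) ^ N) := by
    have hne : (g + N).choose N ≠ 0 := (Nat.choose_pos (Nat.le_add_left N g)).ne'
    rw [aux_norm_nat_val hp _ hne, one_le_inv_mul₀ (by positivity)]
    have h1 : p ^ padicValNat p ((g + N).choose N) ≤ p ^ H * p ^ N := by
      rcases Nat.eq_zero_or_pos (g + N) with h0 | h0
      · rw [h0]
        have : N = 0 := by omega
        subst this
        simpa using Nat.one_le_pow _ _ hpf.out.pos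
      · have h2 := Nat.pow_factorization_choose_le (p := p) (n := g + N) (k := N) h0
        rw [Nat.factorization_def _ hpf.out] at h2
        refine h2.trans ?_
        have h3 : N < p ^ N := Nat.lt_pow_self hpf.out.one_lt
        have h4 : 1 ≤ p ^ H := Nat.one_le_pow _ _ hpf.out.pos
        calc g + N ≤ p ^ H + p ^ H * N := by nlinarith
          _ = p ^ H * (N + 1) := by ring
          _ ≤ _ := Nat.mul_le_mul_left _ h3
    exact_mod_cast h1
  have e : (p : ℝ) ^ c.num.natAbs * ((p : ℝ) ^ (2 + c.den)) ^ N =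
      (p : ℝ) ^ N * ((p : ℝ) ^ H * (p : ℝ) ^ N) := by
    rw [hH, ← pow_mul, ← pow_add, ← pow_add, ← pow_add]
    congr 1
    ring
  rw [e]
  calc (1 : ℝ) ≤ (‖(N.factorial : L)‖ * (p : ℝ) ^ N) *
        (‖(((g + N).choose N : ℕ) : L)‖ * ((p : ℝ) ^ H * (p : ℝ) ^ N)) :=
        one_le_mul_of_one_le_of_one_le hf hch
    _ = _ := by ring

theorem aux_one_le_prod {ι : Type*} [Fintype ι] (f : ι → ℝ) (h : ∀ i, 1 ≤ f i) :
    1 ≤ ∏ i, f i :=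
  Finset.prod_induction f (fun x => 1 ≤ x)
    (fun _ _ ha hb => one_le_mul_of_one_le_of_one_le ha hb) le_rfl (fun i _ => h i)

theorem aux_up_det (hp : ‖(p : L)‖ = (p : ℝ)⁻¹) {ν : ℕ}
    (A : Matrix (Fin ν) (Fin ν) ℚ) (γ : Fin ν → ℚ)
    (hcp : A.charpoly = ∏ j, (X - C (γ j))) (hint : ∀ j, ‖((γ j : ℚ) : L)‖ ≤ 1)
    (hz : ∀ j, ∀ z : ℤ, γ j ≠ (z : ℚ)) :
    ∃ D E : ℝ, 1 ≤ D ∧ 1 ≤ E ∧ ∀ N : ℕ,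
      1 ≤ ‖(upProd (A.map (fun q : ℚ => (q : L))) N).det‖ * (D * E ^ N) := by
  choose D E hD hE h using fun j => aux_poch_lower hp (γ j) (hint j) (hz j)
  set A' : Matrix (Fin ν) (Fin ν) L := A.map (fun q : ℚ => (q : L)) with hA'
  have hA'' : A' = A.map (Rat.castHom L) := rfl
  have hch : A'.charpoly = ∏ j, (X - C ((γ j : ℚ) : L)) := by
    rw [hA'', Matrix.charpoly_map, hcp, Polynomial.map_prod]
    simp
  have hdet1 : ∀ t : L, (A' + t • (1 : Matrix (Fin ν) (Fin ν) L)).det =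
      ∏ j, (((γ j : ℚ) : L) + t) := by
    intro t
    have h1 := Matrix.eval_charpoly A' (-t)
    rw [hch, eval_prod] at h1
    have h2 : Matrix.scalar (Fin ν) (-t) - A' = -(A' + t • (1 : Matrix (Fin ν) (Fin ν) L)) := by
      rw [Matrix.scalar_apply, ← Matrix.smul_one_eq_diagonal, neg_smul]
      abel
    rw [h2, Matrix.det_neg] at h1
    have h3 : ∏ j, eval (-t) (X - C ((γ j : ℚ) : L)) =
        (-1) ^ Fintype.card (Fin ν) * ∏ j, (((γ j : ℚ) : L) + t) := by
      rw [← Finset.card_univ, ← Finset.prod_const, ← Finset.prod_mul_distrib]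
      refine Finset.prod_congr rfl fun j _ => ?_
      simp
      ring
    rw [h3] at h1
    exact (mul_left_cancel₀ (pow_ne_zero _ (by norm_num)) h1).symm
  have hdet : ∀ N : ℕ, (upProd A' N).det =
      ∏ j, ∏ k ∈ Finset.range N, (((γ j : ℚ) : L) + ((k : L) + 1)) := by
    intro N
    rw [Finset.prod_comm]
    induction N with
    | zero => simp [upProd]
    | succ N ih =>
      rw [upProd, Matrix.det_mul, ih, hdet1, Finset.prod_range_succ, mul_comm]
  refine ⟨∏ j, D j, ∏ j, E j, ?_, ?_, fun N => ?_⟩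
  · exact aux_one_le_prod _ (fun j => hD j)
  · exact aux_one_le_prod _ (fun j => hE j)
  · rw [hdet, norm_prod, ← Finset.prod_pow, ← Finset.prod_mul_distrib, ← Finset.prod_mul_distrib]
    exact aux_one_le_prod _ (fun j => h j N)

end helpers

theorem aux_root_lim (K : ℝ) (hK : 0 < K) (k : ℕ) :
    Tendsto (fun n : ℕ => (K * ((n : ℝ) + 1) ^ k) ^ ((1 : ℝ) / n)) atTop (nhds 1) := by
  have h1 : Tendsto (fun n : ℕ => (1 : ℝ) / n) atTop (nhds 0) :=
    tendsto_one_div_atTop_nhds_zero_nat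
  have h2 : Tendsto (fun n : ℕ => K ^ ((1 : ℝ) / n)) atTop (nhds 1) := by
    have := (Real.continuousAt_const_rpow (b := 0) hK.ne').tendsto.comp h1
    rw [Real.rpow_zero] at this
    exact this
  have h3 : Tendsto (fun n : ℕ => ((n : ℝ) + 1) ^ ((1 : ℝ) / n)) atTop (nhds 1) := by
    have h := (tendsto_rpow_div_mul_add 1 1 (-1) (by norm_num)).comp
      (tendsto_atTop_add_const_right atTop (1 : ℝ) tendsto_natCast_atTop_atTop)
    refine h.congr fun n => ?_
    simp
  have h4 := h2.mul (h3.pow k)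
  rw [one_pow, mul_one] at h4
  refine h4.congr fun n => ?_
  have hn : (0 : ℝ) ≤ (n : ℝ) + 1 := by positivity
  rw [Real.mul_rpow hK.le (by positivity), ← Real.rpow_natCast, ← Real.rpow_natCast,
    ← Real.rpow_mul hn, ← Real.rpow_mul hn, mul_comm (k : ℝ)]

theorem aux_limsup {ι : Type*} (F : Filter ι) [F.NeBot] (s : ι → ℕ) (hs : Tendsto s F atTop)
    (y z : ι → ℝ) (hy : ∀ i, 0 ≤ y i) (hz : ∀ i, 0 ≤ z i) (K ρ D E : ℝ) (k : ℕ)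
    (hK : 0 < K) (hρ : 0 < ρ) (hD : 0 < D) (hE : 0 < E)
    (h1 : ∀ i, z i ≤ y i * (K * ((s i : ℝ) + 1) ^ k * ρ ^ s i))
    (h2 : ∀ i, y i ≤ z i * (D * E ^ s i)) :
    limsup (fun i => z i ^ ((1 : ℝ) / (s i : ℕ))) F ≤
      ρ * limsup (fun i => y i ^ ((1 : ℝ) / (s i : ℕ))) F := by
  have hroot : ∀ (K ρ : ℝ), 0 < K → 0 < ρ → ∀ k : ℕ,
      Tendsto (fun i => (K * ((s i : ℝ) + 1) ^ k * ρ ^ s i) ^ ((1 : ℝ) / (s i : ℕ))) F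
        (nhds ρ) := by
    intro K ρ hK hρ k
    have h := ((aux_root_lim K hK k).comp hs).mul_const ρ
    rw [one_mul] at h
    refine h.congr' ?_
    filter_upwards [hs.eventually (eventually_gt_atTop 0)] with i hi
    rw [Real.mul_rpow (by positivity) (by positivity), one_div,
      Real.pow_rpow_inv_natCast hρ.le hi.ne']
    simp
  have mono : ∀ {a b : ℝ} (i : ι), 0 ≤ a → a ≤ b →
      a ^ ((1 : ℝ) / (s i : ℕ)) ≤ b ^ ((1 : ℝ) / (s i : ℕ)) := fun i ha hab =>
    Real.rpow_le_rpow ha hab (by positivity)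
  have hcobz : IsCoboundedUnder (· ≤ ·) F (fun i => z i ^ ((1 : ℝ) / (s i : ℕ))) :=
    IsBoundedUnder.isCoboundedUnder_le
      (isBoundedUnder_of ⟨0, fun i => Real.rpow_nonneg (hz i) _⟩)
  by_cases hb : IsBoundedUnder (· ≤ ·) F (fun i => y i ^ ((1 : ℝ) / (s i : ℕ)))
  · set l := limsup (fun i => y i ^ ((1 : ℝ) / (s i : ℕ))) F with hl
    have hl0 : 0 ≤ l := le_limsup_of_frequently_le
      (Frequently.of_forall fun i => Real.rpow_nonneg (hy i) _) hb
    have hε : ∀ ε : ℝ, 0 < ε →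
        limsup (fun i => z i ^ ((1 : ℝ) / (s i : ℕ))) F ≤ (ρ + ε) * (l + ε) := by
      intro ε hε
      refine limsup_le_of_le hcobz ?_
      have e1 := eventually_lt_of_limsup_lt (show limsup _ F < l + ε by rw [← hl]; linarith) hb
      have e2 := (hroot K ρ hK hρ k).eventually (eventually_lt_nhds (show ρ < ρ + ε by linarith))
      filter_upwards [e1, e2] with i hi1 hi2
      refine (mono i (hz i) (h1 i)).trans ?_
      rw [Real.mul_rpow (hy i) (by positivity), mul_comm]
      exact mul_le_mul hi2.le hi1.le (Real.rpow_nonneg (hy i) _) (by positivity)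
    have hlim : Tendsto (fun ε : ℝ => (ρ + ε) * (l + ε)) (nhdsWithin 0 (Set.Ioi 0))
        (nhds (ρ * l)) := by
      have : Continuous (fun ε : ℝ => (ρ + ε) * (l + ε)) := by fun_prop
      have h := this.tendsto 0
      simp only [add_zero] at h
      exact h.mono_left nhdsWithin_le_nhds
    exact ge_of_tendsto hlim (eventually_nhdsWithin_of_forall fun ε h => hε ε h)
  · have hbz : ¬ IsBoundedUnder (· ≤ ·) F (fun i => z i ^ ((1 : ℝ) / (s i : ℕ))) := by
      rintro ⟨a, ha⟩
      rw [eventually_map] at ha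
      apply hb
      refine ⟨a * (E + 1), ?_⟩
      rw [eventually_map]
      have e2 := (hroot D E hD hE 0).eventually (eventually_lt_nhds (show E < E + 1 by linarith))
      filter_upwards [ha, e2] with i hi1 hi2
      refine (mono i (hy i) (h2 i)).trans ?_
      rw [Real.mul_rpow (hz i) (by positivity)]
      rw [pow_zero, mul_one] at hi2
      exact mul_le_mul hi1 hi2.le (by positivity) ((Real.rpow_nonneg (hz i) _).trans hi1)
    have hzero : ∀ u : ι → ℝ, ¬ IsBoundedUnder (· ≤ ·) F u → limsup u F = 0 := by
      intro u hu
      rw [limsup_eq]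
      have : {a | ∀ᶠ n in F, u n ≤ a} = ∅ := by
        rw [Set.eq_empty_iff_forall_notMem]
        intro a ha
        exact hu ⟨a, by rw [eventually_map]; exact ha⟩
      rw [this, Real.sInf_empty]
    rw [hzero _ hb, hzero _ hbz, mul_zero]

/-- Let `Λ_1,…,Λ_d ∈ GL_ν(ℚ)` be pairwise commuting with all eigenvalues in
`ℚ ∩ ℤ_p \ ℤ`, `τ ≠ 0`, and `Z_α = Y_α ∏_i C_{Λ_i,τ}(α_i)`. Then
`limsup_{|α|→∞} ‖Z_α‖_v^{1/|α|} ≤ p^{-1/(p-1)} |τ|_v⁻¹ limsup_{|α|→∞} ‖Y_α‖_v^{1/|α|}`. -/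
theorem laplace_coefficient_limsup_bound
    (p : ℕ) [Fact p.Prime] {L : Type*} [NontriviallyNormedField L] [CharZero L]
    (hna : ∀ x y : L, ‖x + y‖ ≤ max ‖x‖ ‖y‖) (hp : ‖(p : L)‖ = (p : ℝ)⁻¹)
    (τ : L) (hτ : τ ≠ 0) (d : ℕ) (hd : 1 ≤ d) (μ ν : ℕ) [NeZero μ] [NeZero ν]
    (Λ : Fin d → Matrix (Fin ν) (Fin ν) ℚ)
    (hΛ : ∀ i, IsUnit (Λ i).det)
    (hcomm : ∀ i i', Λ i * Λ i' = Λ i' * Λ i)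
    (γ : Fin d → Fin ν → ℚ)
    (hcp : ∀ i, (Λ i).charpoly = ∏ j, (Polynomial.X - Polynomial.C (γ i j)))
    (hint : ∀ i j, ‖((γ i j : ℚ) : L)‖ ≤ 1)
    (hnotZ : ∀ i j, ∀ z : ℤ, γ i j ≠ (z : ℚ))
    (Y : (Fin d → ℕ) → Matrix (Fin μ) (Fin ν) L) :
    limsup
      (fun α : Fin d → ℕ =>
        matMaxNorm
          (Y α *
            (List.ofFn (fun i : Fin d =>
              τ⁻¹ ^ α i • upProd ((Λ i).map (fun q : ℚ => (q : L))) (α i))).prod)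
          ^ ((1 : ℝ) / (∑ i, α i : ℕ)))
      (comap (fun α : Fin d → ℕ => ∑ i, α i) atTop)
    ≤ (p : ℝ) ^ (-(1 : ℝ) / ((p : ℝ) - 1)) * ‖τ‖⁻¹ *
        limsup (fun α : Fin d → ℕ => matMaxNorm (Y α) ^ ((1 : ℝ) / (∑ i, α i : ℕ)))
          (comap (fun α : Fin d → ℕ => ∑ i, α i) atTop) := by
  have hu : IsUltrametricDist L :=
    IsUltrametricDist.isUltrametricDist_of_forall_norm_add_le_max_norm hna
  have hp1 : (1 : ℝ) < p := by exact_mod_cast (Fact.out : p.Prime).one_lt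
  have hτ0 : 0 < ‖τ‖ := norm_pos_iff.2 hτ
  set π : ℝ := (p : ℝ) ^ (-(1 : ℝ) / ((p : ℝ) - 1)) with hπdef
  have hπ : 0 < π := by positivity
  set ρ : ℝ := π * ‖τ‖⁻¹ with hρdef
  have hρ : 0 < ρ := by positivity
  choose K hK hKu using fun i => aux_up_upper hp (Λ i) (γ i) (hcp i) (hint i)
  choose D E hD hE hDE using fun i => aux_up_det hp (Λ i) (γ i) (hcp i) (hint i) (hnotZ i)
  set s : (Fin d → ℕ) → ℕ := fun α => ∑ i, α i with hs
  set M : (Fin d → ℕ) → Matrix (Fin ν) (Fin ν) L := fun α => (List.ofFn (fun i : Fin d =>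
    τ⁻¹ ^ α i • upProd ((Λ i).map (fun q : ℚ => (q : L))) (α i))).prod with hM
  have hK1 : 1 ≤ ∏ i, K i := aux_one_le_prod _ hK
  have hup : ∀ α, matMaxNorm (M α) ≤
      (∏ i, K i) * ((s α : ℝ) + 1) ^ ((ν + 1) * d) * ρ ^ s α := by
    intro α
    refine (aux_mat_list _).trans ?_
    rw [List.map_ofFn, List.prod_ofFn]
    have hle : ∀ i, (matMaxNorm ∘ fun i : Fin d =>
        τ⁻¹ ^ α i • upProd ((Λ i).map (fun q : ℚ => (q : L))) (α i)) i ≤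
        K i * ((s α : ℝ) + 1) ^ (ν + 1) * ρ ^ α i := by
      intro i
      refine (aux_mat_smul _ _).trans ?_
      rw [norm_pow, norm_inv]
      have h1 : (α i : ℝ) ≤ s α := by
        exact_mod_cast Finset.single_le_sum (f := α) (fun _ _ => Nat.zero_le _) (Finset.mem_univ i)
      have hKi : 0 ≤ K i := zero_le_one.trans (hK i)
      calc ‖τ‖⁻¹ ^ α i * matMaxNorm (upProd ((Λ i).map (fun q : ℚ => (q : L))) (α i))
          ≤ ‖τ‖⁻¹ ^ α i * (K i * ((α i : ℝ) + 1) ^ (ν + 1) * π ^ α i) := by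
            gcongr
            exact hKu i (α i)
        _ = K i * ((α i : ℝ) + 1) ^ (ν + 1) * ρ ^ α i := by rw [hρdef, mul_pow]; ring
        _ ≤ _ := by gcongr
    refine (Finset.prod_le_prod (fun _ _ => aux_mat_nonneg _) (fun i _ => hle i)).trans ?_
    rw [Finset.prod_mul_distrib, Finset.prod_mul_distrib, Finset.prod_const, Finset.card_univ,
      Fintype.card_fin, ← pow_mul, Finset.prod_pow_eq_pow_sum]
  set T : ℝ := ∏ i, (E i * max 1 (‖τ‖ ^ ν)) with hT
  have hEm : ∀ i, 1 ≤ E i * max 1 (‖τ‖ ^ ν) := fun i =>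
    one_le_mul_of_one_le_of_one_le (hE i) (le_max_left _ _)
  have hdet : ∀ α, 1 ≤ ‖(M α).det‖ * ((∏ i, D i) * T ^ s α) := by
    intro α
    have h1 : ‖(M α).det‖ = ∏ i, (‖τ‖⁻¹ ^ α i) ^ ν *
        ‖(upProd ((Λ i).map (fun q : ℚ => (q : L))) (α i)).det‖ := by
      have : (M α).det = ∏ i, (τ⁻¹ ^ α i • upProd ((Λ i).map (fun q : ℚ => (q : L))) (α i)).det := by
        have h := map_list_prod (Matrix.detMonoidHom (n := Fin ν) (R := L)) (List.ofFn (fun i : Fin d =>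
          τ⁻¹ ^ α i • upProd ((Λ i).map (fun q : ℚ => (q : L))) (α i)))
        rw [List.map_ofFn, List.prod_ofFn] at h
        exact h
      rw [this, norm_prod]
      refine Finset.prod_congr rfl fun i _ => ?_
      rw [Matrix.det_smul, norm_mul, Fintype.card_fin, norm_pow, norm_pow, norm_inv]
    rw [h1, hT]
    have h2 : ∀ i, (E i * max 1 (‖τ‖ ^ ν)) ^ α i ≤ T ^ α i := by
      intro i
      refine pow_le_pow_left₀ (zero_le_one.trans (hEm i)) ?_ _
      rw [hT, ← Finset.mul_prod_erase Finset.univ _ (Finset.mem_univ i)]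
      refine le_mul_of_one_le_right (zero_le_one.trans (hEm i)) ?_
      exact Finset.prod_induction _ (fun x : ℝ => 1 ≤ x)
        (fun _ _ ha hb => one_le_mul_of_one_le_of_one_le ha hb) le_rfl (fun j _ => hEm j)
    rw [← hT, hs]
    simp only
    rw [← Finset.prod_pow_eq_pow_sum, ← Finset.prod_mul_distrib, ← Finset.prod_mul_distrib]
    refine aux_one_le_prod _ fun i => ?_
    set x := ‖(upProd ((Λ i).map (fun q : ℚ => (q : L))) (α i)).det‖ with hx
    have h3 : 1 ≤ x * (D i * E i ^ α i) := hDE i (α i)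
    have h4 : (‖τ‖⁻¹ ^ α i) ^ ν * (‖τ‖ ^ ν) ^ α i = 1 := by
      rw [← pow_mul, ← pow_mul, mul_comm ν, ← mul_pow, inv_mul_cancel₀ hτ0.ne', one_pow]
    have hD0 : 0 ≤ D i := zero_le_one.trans (hD i)
    have hE0 : 0 ≤ E i := zero_le_one.trans (hE i)
    have hx0 : 0 ≤ x := norm_nonneg _
    calc (1 : ℝ) ≤ x * (D i * E i ^ α i) := h3
      _ = (‖τ‖⁻¹ ^ α i) ^ ν * x * (D i * (E i * ‖τ‖ ^ ν) ^ α i) := by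
          rw [mul_pow]; linear_combination (-(x * (D i * E i ^ α i))) * h4
      _ ≤ (‖τ‖⁻¹ ^ α i) ^ ν * x * (D i * (E i * max 1 (‖τ‖ ^ ν)) ^ α i) := by
          gcongr
          exact le_max_right _ _
      _ ≤ _ := by
          have := h2 i
          have h5 : 0 ≤ (‖τ‖⁻¹ ^ α i) ^ ν * x := by positivity
          exact mul_le_mul_of_nonneg_left (mul_le_mul_of_nonneg_left this hD0) h5
  have hT1 : 1 ≤ T := aux_one_le_prod _ hEm
  have hD1 : 1 ≤ ∏ i, D i := aux_one_le_prod _ hD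
  set W : ℝ := 2 ^ ((ν + 1) * d) * max 1 ρ with hW
  have hW1 : 1 ≤ W := one_le_mul_of_one_le_of_one_le (one_le_pow₀ (by norm_num)) (le_max_left _ _)
  have hup2 : ∀ α, matMaxNorm (M α) ≤ (∏ i, K i) * W ^ s α := by
    intro α
    refine (hup α).trans ?_
    have h1 : (s α : ℝ) + 1 ≤ 2 ^ s α := by
      exact_mod_cast (Nat.lt_two_pow_self : s α < 2 ^ s α)
    have hK0 : 0 ≤ ∏ i, K i := zero_le_one.trans hK1
    have h2 : ((s α : ℝ) + 1) ^ ((ν + 1) * d) ≤ ((2 : ℝ) ^ ((ν + 1) * d)) ^ s α := by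
      rw [pow_right_comm]
      exact pow_le_pow_left₀ (by positivity) h1 _
    have h3 : ρ ^ s α ≤ (max 1 ρ) ^ s α := pow_le_pow_left₀ hρ.le (le_max_right _ _) _
    have h4 : W ^ s α = ((2 : ℝ) ^ ((ν + 1) * d)) ^ s α * (max 1 ρ) ^ s α := by
      rw [hW]; exact mul_pow _ _ _
    rw [h4, mul_assoc]
    exact mul_le_mul_of_nonneg_left
      (mul_le_mul h2 h3 (pow_nonneg hρ.le _) (by positivity)) hK0
  have : (comap s atTop).NeBot := by
    rw [comap_neBot_iff_frequently]
    refine Frequently.of_forall fun n => ?_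
    have hd0 : 0 < d := hd
    refine ⟨Pi.single ⟨0, hd0⟩ n, ?_⟩
    simp [hs]
  have hfin := aux_limsup (comap s atTop) s tendsto_comap (fun α => matMaxNorm (Y α))
    (fun α => matMaxNorm (Y α * M α)) (fun α => aux_mat_nonneg _) (fun α => aux_mat_nonneg _)
    (∏ i, K i) ρ ((∏ i, D i) * (∏ i, K i) ^ ν) (T * W ^ ν) ((ν + 1) * d)
    (by linarith) hρ (by positivity) (by positivity)
    (fun α => (aux_mat_mul _ _).trans (mul_le_mul_of_nonneg_left (hup α) (aux_mat_nonneg _)))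
    (fun α => by
      have h1 : 1 ≤ (∏ i, K i) * W ^ s α :=
        one_le_mul_of_one_le_of_one_le hK1 (one_le_pow₀ hW1)
      have h2 := aux_inv (Y α) (M α) _ _ h1 (hup2 α) (hdet α)
      rw [Fintype.card_fin] at h2
      refine h2.trans (le_of_eq ?_)
      clear_value W T
      rw [mul_pow, mul_pow, ← pow_mul, ← pow_mul, mul_comm ν]
      ring)
  exact hfin
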